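/- arXiv:math/0608360 — 2 statements merged into one kernel-verified Lean document; each statement's English description precedes it below -/
import Mathlib

section
/- For every graph G, every base vertex v0, and every positive integer k, the k-th symmetric Abel-Jacobi map S^{(k)} : Div_+^k(G) → Jac(G) is surjective if and only if k ≥ g, where g is the genus of G. -/
open Finset

variable {V : Type}

def mdeg [Fintype V] (m : V → V → ℕ) (v : V) : ℕ := ∑ w, m v w

def laplacian [Fintype V] (m : V → V → ℕ) (f : V → ℤ) : V → ℤ :=
  fun v => (mdeg m v : ℤ) * f v - ∑ w, (m v w : ℤ) * f w

def LinEquiv [Fintype V] (m : V → V → ℕ) (D D' : V → ℤ) : Prop :=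
  ∃ f : V → ℤ, D - D' = laplacian m f

def Effective (D : V → ℤ) : Prop := ∀ v, 0 ≤ D v

def divDeg [Fintype V] (D : V → ℤ) : ℤ := ∑ v, D v

def edgeCount [Fintype V] (m : V → V → ℕ) : ℤ := (∑ v, ∑ w, (m v w : ℤ)) / 2

def genus [Fintype V] (m : V → V → ℕ) : ℤ := edgeCount m - Fintype.card V + 1

def IsGraph [Fintype V] (m : V → V → ℕ) : Prop :=
  (∀ v w, m v w = m w v) ∧ (∀ v, m v v = 0) ∧
  (SimpleGraph.fromRel (fun v w => 0 < m v w)).Connected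

lemma laplacian_zero [Fintype V] (m : V → V → ℕ) : laplacian m (0 : V → ℤ) = 0 := by
  funext v; simp [laplacian]

lemma laplacian_add [Fintype V] (m : V → V → ℕ) (f g : V → ℤ) :
    laplacian m (f + g) = laplacian m f + laplacian m g := by
  funext v
  simp only [laplacian, Pi.add_apply, mul_add, Finset.sum_add_distrib]
  ring

lemma laplacian_neg [Fintype V] (m : V → V → ℕ) (f : V → ℤ) :
    laplacian m (-f) = - laplacian m f := by
  funext v
  simp only [laplacian, Pi.neg_apply, mul_neg, Finset.sum_neg_distrib]
  ring

/-- Linear equivalence is an equivalence relation. -/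
def linSetoid [Fintype V] (m : V → V → ℕ) : Setoid (V → ℤ) where
  r := LinEquiv m
  iseqv := by
    constructor
    · intro D
      exact ⟨0, by rw [laplacian_zero]; simp⟩
    · rintro D D' ⟨f, hf⟩
      refine ⟨-f, ?_⟩
      rw [laplacian_neg, ← hf]
      abel
    · rintro D D' D'' ⟨f, hf⟩ ⟨g, hg⟩
      refine ⟨f + g, ?_⟩
      rw [laplacian_add, ← hf, ← hg]
      abel

/-- The setoid on degree-zero divisors induced by linear equivalence. -/
def jacSetoid [Fintype V] (m : V → V → ℕ) : Setoid {D : V → ℤ // divDeg D = 0} :=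
  (linSetoid m).comap Subtype.val

/-- The Jacobian group of the graph, as the set of linear equivalence classes
of degree-zero divisors. -/
def Jac [Fintype V] (m : V → V → ℕ) : Type _ := Quotient (jacSetoid m)

/-- The divisor `(v0)`. -/
def basisDiv [DecidableEq V] (v0 : V) : V → ℤ := fun v => if v = v0 then 1 else 0

lemma divDeg_basisDiv [Fintype V] [DecidableEq V] (v0 : V) :
    divDeg ((basisDiv v0 : V → ℤ)) = 1 := by
  simp [divDeg, basisDiv]

/-- The `k`-th symmetric power of the Abel–Jacobi map, defined on effective divisors of
degree `k`, sending `E` to the class of `E - k (v0)`. -/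
def abelJacobi [Fintype V] [DecidableEq V] (m : V → V → ℕ) (v0 : V) (k : ℕ)
    (E : {E : V → ℤ // Effective E ∧ divDeg E = (k : ℤ)}) : Jac m :=
  Quotient.mk (jacSetoid m) ⟨E.1 - (k : ℤ) • basisDiv v0, by
    have h1 : divDeg (E.1 - (k : ℤ) • basisDiv v0)
        = divDeg E.1 - (k : ℤ) * divDeg (basisDiv v0 : V → ℤ) := by
      simp [divDeg, Finset.sum_sub_distrib, Finset.mul_sum]
    rw [h1, divDeg_basisDiv, E.2.2]
    ring⟩

lemma laplacian_eq [Fintype V] (m : V → V → ℕ) (f : V → ℤ) (v : V) :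
    laplacian m f v = ∑ w, (m v w : ℤ) * (f v - f w) := by
  simp [laplacian, mdeg, mul_sub, Finset.sum_sub_distrib, Finset.sum_mul]

lemma sum_laplacian_mul [Fintype V] (m : V → V → ℕ) (hs : ∀ v w, m v w = m w v) (f g : V → ℤ) :
    ∑ v, laplacian m f v * g v = ∑ v, f v * laplacian m g v := by
  simp only [laplacian, sub_mul, mul_sub, Finset.sum_sub_distrib, Finset.sum_mul, Finset.mul_sum]
  congr 1
  · exact Finset.sum_congr rfl fun v _ => by ring
  · rw [Finset.sum_comm]
    refine Finset.sum_congr rfl fun v _ => Finset.sum_congr rfl fun w _ => ?_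
    rw [hs w v]; ring

lemma sum_laplacian [Fintype V] (m : V → V → ℕ) (hs : ∀ v w, m v w = m w v) (f : V → ℤ) :
    ∑ v, laplacian m f v = 0 := by
  have h := sum_laplacian_mul m hs f (fun _ => 1)
  simpa [laplacian_eq] using h

lemma exists_potential [Fintype V] (m : V → V → ℕ) (hm : IsGraph m) (v0 : V) :
    ∃ f : V → ℤ, f v0 = 0 ∧ (∀ v, 0 ≤ f v) ∧ ∀ v, v ≠ v0 → 1 ≤ laplacian m f v := by
  classical
  obtain ⟨hs, h0, hc⟩ := hm
  set G := SimpleGraph.fromRel (fun v w => 0 < m v w) with hG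
  let d : V → ℕ := fun v => G.dist v v0
  have hd : ∀ v, v ≠ v0 → ∃ w, 0 < m v w ∧ d w + 1 ≤ d v := by
    intro v hv
    obtain ⟨p, hp⟩ := (hc.preconnected v v0).exists_walk_length_eq_dist
    cases p with
    | nil => exact absurd rfl hv
    | @cons _ w _ h p =>
      refine ⟨w, ?_, ?_⟩
      · rw [hG, SimpleGraph.fromRel_adj] at h
        rcases h.2 with h | h
        · exact h
        · rw [hs]; exact h
      · have := SimpleGraph.dist_le p
        simp only [SimpleGraph.Walk.length_cons] at hp
        show G.dist w v0 + 1 ≤ G.dist v v0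
        omega
  let N : ℕ := ∑ v, d v
  have hN : ∀ v, d v ≤ N := fun v => Finset.single_le_sum (f := d) (fun _ _ => Nat.zero_le _) (Finset.mem_univ v)
  let c : ℤ := 1 + ∑ v, ∑ w, (m v w : ℤ)
  have hc1 : 1 ≤ c := by
    have : 0 ≤ ∑ v, ∑ w, (m v w : ℤ) := by positivity
    show 1 ≤ 1 + _
    linarith
  have hdeg : ∀ v, 1 + ∑ w, (m v w : ℤ) ≤ c := fun v => by
    have := Finset.single_le_sum (f := fun v => ∑ w, (m v w : ℤ)) (fun _ _ => by positivity) (Finset.mem_univ v)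
    show 1 + _ ≤ 1 + _
    linarith
  refine ⟨fun v => c ^ N - c ^ (N - d v), ?_, ?_, ?_⟩
  · simp [d]
  · intro v
    have := pow_le_pow_right₀ hc1 (Nat.sub_le N (d v))
    simpa using this
  · intro v hv
    obtain ⟨w, hw, hdw⟩ := hd v hv
    rw [laplacian_eq]
    have e : ∑ u, (m v u : ℤ) * ((c ^ N - c ^ (N - d v)) - (c ^ N - c ^ (N - d u)))
        = ∑ u, (m v u : ℤ) * c ^ (N - d u) - (∑ u, (m v u : ℤ)) * c ^ (N - d v) := by
      rw [Finset.sum_mul, ← Finset.sum_sub_distrib]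
      exact Finset.sum_congr rfl fun u _ => by ring
    rw [e]
    have h1 : (m v w : ℤ) * c ^ (N - d w) ≤ ∑ u, (m v u : ℤ) * c ^ (N - d u) :=
      Finset.single_le_sum (f := fun u => (m v u : ℤ) * c ^ (N - d u))
        (fun _ _ => by positivity) (Finset.mem_univ w)
    have h2 : c ^ (N - d v + 1) ≤ c ^ (N - d w) := by
      apply pow_le_pow_right₀ hc1
      have := hN v
      omega
    have h3 : (1:ℤ) ≤ m v w := by exact_mod_cast hw
    have h4 : (1:ℤ) ≤ c ^ (N - d v) := one_le_pow₀ hc1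
    have h5 : c ^ (N - d w) ≤ (m v w : ℤ) * c ^ (N - d w) :=
      le_mul_of_one_le_left (by positivity) h3
    rw [pow_succ] at h2
    have h6 := mul_le_mul_of_nonneg_right (hdeg v) (by linarith : 0 ≤ c ^ (N - d v))
    nlinarith

lemma exists_reduced [Fintype V] [DecidableEq V] (m : V → V → ℕ) (hm : IsGraph m) (v0 : V)
    (D : V → ℤ) : ∃ h : V → ℤ, (∀ v, v ≠ v0 → 0 ≤ (D - laplacian m h) v) ∧
      ∀ A : Finset V, v0 ∉ A → A.Nonempty →
        ∃ v ∈ A, (D - laplacian m h) v + 1 ≤ ∑ w ∈ Aᶜ, (m v w : ℤ) := by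
  obtain ⟨f, hf0, hfn, hf⟩ := exists_potential m hm v0
  have hs := hm.1
  let P : ℕ → Prop := fun n => ∃ h : V → ℤ, (∀ v, v ≠ v0 → 0 ≤ (D - laplacian m h) v) ∧
    ∑ v, (D - laplacian m h) v * f v = n
  have nn : ∀ h : V → ℤ, (∀ v, v ≠ v0 → 0 ≤ (D - laplacian m h) v) →
      0 ≤ ∑ v, (D - laplacian m h) v * f v := by
    intro h hh
    refine Finset.sum_nonneg fun v _ => ?_
    by_cases hv : v = v0
    · simp [hv, hf0]
    · exact mul_nonneg (hh v hv) (hfn v)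
  have hP : ∃ n, P n := by
    let t : ℤ := ∑ v, |D v|
    have key : ∀ v, v ≠ v0 → 0 ≤ (D - laplacian m (fun v => - t * f v)) v := by
      intro v hv
      have e : laplacian m (fun v => - t * f v) v = - t * laplacian m f v := by
        rw [laplacian_eq, laplacian_eq, Finset.mul_sum]
        exact Finset.sum_congr rfl fun u _ => by ring
      rw [Pi.sub_apply, e]
      have h1 : |D v| ≤ t :=
        Finset.single_le_sum (f := fun v => |D v|) (fun _ _ => abs_nonneg _) (Finset.mem_univ v)
      have h2 := neg_abs_le (D v)
      have h3 := hf v hv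
      have h4 := abs_nonneg (D v)
      nlinarith
    exact ⟨_, _, key, (Int.toNat_of_nonneg (nn _ key)).symm⟩
  classical
  obtain ⟨h, hh, hsum⟩ := Nat.find_spec hP
  refine ⟨h, hh, ?_⟩
  intro A hA0 hAne
  by_contra! hcon
  let χ : V → ℤ := fun v => if v ∈ A then 1 else 0
  have hadd : D - laplacian m (h + χ) = (D - laplacian m h) - laplacian m χ := by
    rw [laplacian_add]; abel
  have key : ∀ v, v ≠ v0 → 0 ≤ (D - laplacian m (h + χ)) v := by
    intro v hv
    rw [hadd, Pi.sub_apply, laplacian_eq]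
    by_cases hvA : v ∈ A
    · have e : ∑ w, (m v w : ℤ) * (χ v - χ w) = ∑ w ∈ Aᶜ, (m v w : ℤ) := by
        rw [← Finset.sum_add_sum_compl A]
        rw [Finset.sum_eq_zero, zero_add]
        · refine Finset.sum_congr rfl fun w hw => ?_
          simp only [Finset.mem_compl] at hw
          simp [χ, hvA, hw]
        · intro w hw
          simp [χ, hvA, hw]
      rw [e]
      have := hcon v hvA
      linarith
    · have : ∑ w, (m v w : ℤ) * (χ v - χ w) ≤ 0 := by
        refine Finset.sum_nonpos fun w _ => ?_
        by_cases hw : w ∈ A <;> simp [χ, hvA, hw]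
      have := hh v hv
      linarith
  have hlt : ∑ v, (D - laplacian m (h + χ)) v * f v < ∑ v, (D - laplacian m h) v * f v := by
    have e : ∑ v, (D - laplacian m (h + χ)) v * f v
        = ∑ v, (D - laplacian m h) v * f v - ∑ v, laplacian m χ v * f v := by
      rw [hadd, ← Finset.sum_sub_distrib]
      exact Finset.sum_congr rfl fun v _ => by rw [Pi.sub_apply]; ring
    rw [e, sum_laplacian_mul m hs]
    have e2 : ∑ v, χ v * laplacian m f v = ∑ v ∈ A, laplacian m f v := by
      simp [χ, Finset.sum_ite_mem]
    rw [e2]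
    have : 0 < ∑ v ∈ A, laplacian m f v := by
      refine Finset.sum_pos (fun v hv => ?_) hAne
      have := hf v (fun h => hA0 (h ▸ hv))
      linarith
    linarith
  have hmin := Nat.find_min' hP (m := (∑ v, (D - laplacian m (h + χ)) v * f v).toNat)
    ⟨_, key, (Int.toNat_of_nonneg (nn _ key)).symm⟩
  have := Int.toNat_of_nonneg (nn _ key)
  omega

lemma inner_insert [Fintype V] [DecidableEq V] (m : V → V → ℕ) (hs : ∀ v w, m v w = m w v)
    (h0 : ∀ v, m v v = 0) (A : Finset V) (v : V) (hv : v ∉ A) :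
    ∑ x ∈ insert v A, ∑ y ∈ insert v A, (m x y : ℤ)
      = ∑ x ∈ A, ∑ y ∈ A, (m x y : ℤ) + 2 * ∑ y ∈ A, (m v y : ℤ) := by
  simp only [Finset.sum_insert hv, h0, Finset.sum_add_distrib]
  have : ∑ x ∈ A, (m x v : ℤ) = ∑ x ∈ A, (m v x : ℤ) :=
    Finset.sum_congr rfl fun x _ => by rw [hs]
  rw [this]; push_cast; ring

lemma burn [Fintype V] [DecidableEq V] (m : V → V → ℕ) (hs : ∀ v w, m v w = m w v)
    (h0 : ∀ v, m v v = 0) (v0 : V) (D : V → ℤ)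
    (hD : ∀ A : Finset V, v0 ∉ A → A.Nonempty → ∃ v ∈ A, D v + 1 ≤ ∑ w ∈ Aᶜ, (m v w : ℤ)) :
    ∀ A : Finset V, v0 ∉ A → 2 * ∑ v ∈ A, (D v + 1) + ∑ x ∈ A, ∑ y ∈ A, (m x y : ℤ)
      ≤ 2 * ∑ x ∈ A, ∑ y, (m x y : ℤ) := by
  intro A
  induction A using Finset.strongInduction with
  | H A ih =>
    intro hA
    rcases A.eq_empty_or_nonempty with rfl | hne
    · simp
    obtain ⟨v, hv, hle⟩ := hD A hA hne
    have i := ih (A.erase v) (Finset.erase_ssubset hv) (fun h => hA (Finset.mem_of_mem_erase h))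
    have hnot := Finset.notMem_erase v A
    have e := inner_insert m hs h0 _ v hnot
    rw [Finset.insert_erase hv] at e
    have e1 := Finset.add_sum_erase A (fun v => D v + 1) hv
    have e2 := Finset.add_sum_erase A (fun v => ∑ y, (m v y : ℤ)) hv
    have e3 := Finset.add_sum_erase A (fun y => (m v y : ℤ)) hv
    have e4 := Finset.sum_add_sum_compl A (fun y => (m v y : ℤ))
    simp only [h0] at e1 e2 e3 e4
    push_cast at e3
    linarith

lemma exists_effective [Fintype V] [DecidableEq V] (m : V → V → ℕ) (hm : IsGraph m) (v0 : V)
    (D : V → ℤ) (hD : genus m ≤ divDeg D) : ∃ h : V → ℤ, Effective (D - laplacian m h) := by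
  obtain ⟨h, hh, hred⟩ := exists_reduced m hm v0 D
  refine ⟨h, fun v => ?_⟩
  by_cases hv : v = v0
  swap
  · exact hh v hv
  subst hv
  obtain ⟨hs, h0, -⟩ := hm
  have hnot := Finset.notMem_erase v (Finset.univ : Finset V)
  have b := burn m hs h0 v _ hred (Finset.univ.erase v) hnot
  have e := inner_insert m hs h0 _ v hnot
  rw [Finset.insert_erase (Finset.mem_univ v)] at e
  have e1 := Finset.add_sum_erase Finset.univ (fun v => (D - laplacian m h) v + 1) (Finset.mem_univ v)
  have e2 := Finset.add_sum_erase Finset.univ (fun v => ∑ y, (m v y : ℤ)) (Finset.mem_univ v)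
  have e3 := Finset.add_sum_erase Finset.univ (fun y => (m v y : ℤ)) (Finset.mem_univ v)
  have e5 : ∑ v, ((D - laplacian m h) v + 1) = divDeg D + Fintype.card V := by
    simp [Finset.sum_add_distrib, Finset.sum_sub_distrib, sum_laplacian m hs, divDeg]
  simp only [h0] at e1 e2 e3
  push_cast at e3
  rw [e5] at e1
  unfold genus edgeCount at hD
  generalize (D - laplacian m h) v = x at *
  omega

lemma exists_bad [Fintype V] [DecidableEq V] (m : V → V → ℕ) (hs : ∀ v w, m v w = m w v)
    (h0 : ∀ v, m v v = 0) : ∃ ν : V → ℤ, divDeg ν = genus m - 1 ∧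
      ∀ f : V → ℤ, Nonempty V → ∃ v, (ν + laplacian m f) v < 0 := by
  let r := Fintype.equivFin V
  let ind : V → ℤ := fun v => ∑ w, if r w < r v then (m v w : ℤ) else 0
  refine ⟨fun v => ind v - 1, ?_, ?_⟩
  · have e : 2 * ∑ v, ind v = ∑ v, ∑ w, (m v w : ℤ) := by
      have e1 : ∑ v, ind v = ∑ v, ∑ w, if r v < r w then (m v w : ℤ) else 0 := by
        simp only [ind]
        rw [Finset.sum_comm]
        exact Finset.sum_congr rfl fun v _ => Finset.sum_congr rfl fun w _ => by rw [hs]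
      rw [two_mul]
      nth_rw 2 [e1]
      rw [← Finset.sum_add_distrib]
      refine Finset.sum_congr rfl fun v _ => ?_
      simp only [ind]
      rw [← Finset.sum_add_distrib]
      refine Finset.sum_congr rfl fun w _ => ?_
      rcases lt_trichotomy (r v) (r w) with h | h | h
      · simp [h, h.not_gt]
      · have := r.injective h
        subst this
        simp [h0]
      · simp [h, h.not_gt]
    have e2 : divDeg (fun v => ind v - 1) = ∑ v, ind v - Fintype.card V := by
      simp [divDeg, Finset.sum_sub_distrib]
    rw [e2]
    unfold genus edgeCount
    omega
  · intro f hV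
    obtain ⟨u, -, hu⟩ := Finset.exists_min_image Finset.univ f Finset.univ_nonempty
    obtain ⟨v, hv, hvmin⟩ := Finset.exists_min_image (Finset.univ.filter fun v => f v = f u) r
      ⟨u, by simp⟩
    simp only [Finset.mem_filter, Finset.mem_univ, true_and] at hv hvmin hu
    refine ⟨v, ?_⟩
    have : ind v + laplacian m f v ≤ 0 := by
      rw [laplacian_eq]
      simp only [ind]
      rw [← Finset.sum_add_distrib]
      refine Finset.sum_nonpos fun w _ => ?_
      have hw := hu w trivial
      have hm0 : (0:ℤ) ≤ m v w := by positivity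
      split_ifs with hlt
      · have : f w ≠ f u := fun h => absurd hlt (not_lt.mpr (hvmin w h))
        have : f v - f w ≤ -1 := by omega
        nlinarith
      · have : f v - f w ≤ 0 := by omega
        nlinarith
    simp only [Pi.add_apply]
    linarith

theorem abelJacobi_surjective_iff_genus_le [Fintype V] [DecidableEq V] (m : V → V → ℕ) (hm : IsGraph m)
    (v0 : V) (k : ℕ) (hk : 1 ≤ k) :
    Function.Surjective (abelJacobi m v0 k) ↔ genus m ≤ (k : ℤ) := by
  have hs := hm.1
  constructor
  · intro hsurj
    by_contra! hlt
    obtain ⟨ν, hν, hbad⟩ := exists_bad m hs hm.2.1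
    have hdeg : divDeg (ν - (genus m - 1) • basisDiv v0) = 0 := by
      have := divDeg_basisDiv v0
      simp only [divDeg] at this hν
      simp only [divDeg, Pi.sub_apply, Pi.smul_apply, smul_eq_mul, Finset.sum_sub_distrib,
        ← Finset.mul_sum, this, hν]
      ring
    obtain ⟨⟨E, hE, hEd⟩, hEq⟩ := hsurj (Quotient.mk (jacSetoid m) ⟨_, hdeg⟩)
    obtain ⟨f, hf⟩ : LinEquiv m (E - (k : ℤ) • basisDiv v0) (ν - (genus m - 1) • basisDiv v0) :=
      Quotient.exact hEq
    obtain ⟨v, hv⟩ := hbad f ⟨v0⟩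
    rw [← hf] at hv
    simp only [Pi.add_apply, Pi.sub_apply, Pi.smul_apply, smul_eq_mul] at hv
    have h1 := hE v
    have h2 : 0 ≤ (basisDiv v0 : V → ℤ) v := by unfold basisDiv; split_ifs <;> simp
    nlinarith
  · intro hg q
    induction q using Quotient.inductionOn with
    | h D =>
    obtain ⟨D, hD⟩ := D
    have hdeg : divDeg (D + (k : ℤ) • basisDiv v0) = k := by
      have := divDeg_basisDiv v0
      simp only [divDeg] at this hD
      simp only [divDeg, Pi.add_apply, Pi.smul_apply, smul_eq_mul, Finset.sum_add_distrib,
        ← Finset.mul_sum, this, hD]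
      ring
    obtain ⟨h, hh⟩ := exists_effective m hm v0 (D + (k : ℤ) • basisDiv v0) (by rw [hdeg]; exact hg)
    refine ⟨⟨_, hh, ?_⟩, ?_⟩
    · refine Eq.trans ?_ hdeg
      simp only [divDeg, Pi.sub_apply (D + _), Finset.sum_sub_distrib, sum_laplacian m hs, sub_zero]
    · refine Quotient.sound ?_
      show LinEquiv m _ _
      refine ⟨-h, ?_⟩
      rw [laplacian_neg]
      simp only
      abel
end

section
/- Alternate characterization of rank: In the abstract setting (X a nonempty set, ∼ an equivalence relation on Div(X) satisfying (E1) and (E2), g ≥ 0 an integer), suppose property (RR1) holds: for every D ∈ Div(X) there exists ν ∈ N with exactly one of |D| and |ν − D| empty. Then for every D ∈ Div(X), r(D) = (min over all D' ∼ D and all ν ∈ N of deg^+(D' − ν)) − 1. -/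
variable {X : Type}

/-- Degree of a divisor on the set `X` (an element of the free abelian group on `X`). -/
def adeg (D : X →₀ ℤ) : ℤ := D.sum fun _ a => a

/-- A divisor is effective if all its coefficients are nonnegative. -/
def AEff (D : X →₀ ℤ) : Prop := ∀ x, 0 ≤ D x

/-- `|D| ≠ ∅`: some effective divisor is equivalent to `D`. -/
def AWin (R : (X →₀ ℤ) → (X →₀ ℤ) → Prop) (D : X →₀ ℤ) : Prop := ∃ E, AEff E ∧ R D E

/-- The rank `r(D)` of the linear system of a divisor: the largest `s ≥ -1` such that
`|D - E| ≠ ∅` for every effective divisor `E` of degree `s`. -/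
noncomputable def arank (R : (X →₀ ℤ) → (X →₀ ℤ) → Prop) (D : X →₀ ℤ) : ℤ :=
  sSup {s : ℤ | s = -1 ∨ (0 ≤ s ∧ ∀ E : X →₀ ℤ, AEff E → adeg E = s → AWin R (D - E))}

open Classical in
/-- `ε(D) = 0` if `|D| ≠ ∅` and `ε(D) = 1` if `|D| = ∅`. -/
noncomputable def eps (R : (X →₀ ℤ) → (X →₀ ℤ) → Prop) (D : X →₀ ℤ) : ZMod 2 :=
  if AWin R D then 0 else 1

/-- The set `𝒩` of divisors of degree `g - 1` with empty linear system. -/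
def NSet (R : (X →₀ ℤ) → (X →₀ ℤ) → Prop) (g : ℕ) : Set (X →₀ ℤ) :=
  {D | adeg D = (g : ℤ) - 1 ∧ ¬ AWin R D}

/-- `deg⁺(D)`: the sum of the positive coefficients of `D`. -/
def posdeg (D : X →₀ ℤ) : ℤ := D.sum fun _ a => max a 0

theorem adeg_add' (A B : X →₀ ℤ) : adeg (A + B) = adeg A + adeg B := by
  unfold adeg
  exact Finsupp.sum_add_index' (fun _ => rfl) (fun _ _ _ => rfl)

theorem adeg_nonneg' (A : X →₀ ℤ) (h : AEff A) : 0 ≤ adeg A :=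
  Finset.sum_nonneg fun x _ => h x

/-- positive part -/
noncomputable def posp (A : X →₀ ℤ) : X →₀ ℤ := A.mapRange (fun a => max a 0) (by simp)

theorem adeg_posp (A : X →₀ ℤ) : adeg (posp A) = posdeg A := by
  unfold adeg posp posdeg
  exact Finsupp.sum_mapRange_index (fun _ => rfl)

theorem posp_apply (A : X →₀ ℤ) (x : X) : posp A x = max (A x) 0 := by
  simp [posp]

theorem posp_eff (A : X →₀ ℤ) : AEff (posp A) := fun x => by simp [posp_apply]

theorem posdeg_le (E F : X →₀ ℤ) (hE : AEff E) (hF : AEff F) : posdeg (E - F) ≤ adeg E := by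
  have h1 : AEff (E - posp (E - F)) := fun x => by
    have := hE x
    have := hF x
    simp only [Finsupp.sub_apply, posp_apply]
    omega
  have h2 := adeg_add' (E - posp (E - F)) (posp (E - F))
  have h3 := adeg_nonneg' _ h1
  rw [sub_add_cancel, adeg_posp] at h2
  omega

theorem rank_alternate_characterization [Nonempty X]
    (R : (X →₀ ℤ) → (X →₀ ℤ) → Prop)
    (hequiv : Equivalence R)
    (hE1 : ∀ D D', R D D' → adeg D = adeg D')
    (hE2 : ∀ D₁ D₁' D₂ D₂', R D₁ D₁' → R D₂ D₂' → R (D₁ + D₂) (D₁' + D₂'))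
    (g : ℕ)
    (hRR1 : ∀ D : X →₀ ℤ, ∃ ν ∈ NSet R g, (AWin R D ↔ ¬ AWin R (ν - D)))
    (D : X →₀ ℤ) :
    arank R D =
      sInf {t : ℤ | ∃ D' ν : X →₀ ℤ, R D D' ∧ ν ∈ NSet R g ∧ t = posdeg (D' - ν)} - 1 := by
  set T := {t : ℤ | ∃ D' ν : X →₀ ℤ, R D D' ∧ ν ∈ NSet R g ∧ t = posdeg (D' - ν)} with hT
  have hTne : T.Nonempty := by
    obtain ⟨ν, hν, -⟩ := hRR1 D
    exact ⟨_, D, ν, hequiv.refl D, hν, rfl⟩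
  have hT0 : ∀ t ∈ T, 0 ≤ t := by
    rintro t ⟨D', ν, -, -, rfl⟩
    rw [← adeg_posp]
    exact adeg_nonneg' _ (posp_eff _)
  have hTb : BddBelow T := ⟨0, hT0⟩
  have hm := Int.csInf_mem hTne hTb
  have hmin : ∀ t ∈ T, sInf T ≤ t := fun t ht => csInf_le hTb ht
  generalize sInf T = m at hm hmin ⊢
  have hm0 := hT0 m hm
  apply IsGreatest.csSup_eq
  constructor
  · by_cases h0 : m = 0
    · left; omega
    · right
      refine ⟨by omega, fun E hE hdeg => ?_⟩
      by_contra hcon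
      obtain ⟨ν, hν, hiff⟩ := hRR1 (D - E)
      have hw : AWin R (ν - (D - E)) := by tauto
      obtain ⟨F, hF, hR⟩ := hw
      have h1 := hE2 _ _ _ _ (hequiv.symm hR) (hequiv.refl (D - F))
      rw [show F + (D - F) = D by abel,
        show ν - (D - E) + (D - F) = ν + (E - F) by abel] at h1
      have h2 := hmin _ ⟨_, ν, h1, hν, rfl⟩
      rw [add_sub_cancel_left] at h2
      have := posdeg_le E F hE hF
      omega
  · rintro s (hs | ⟨hs0, hs⟩)
    · omega
    · by_contra hlt
      obtain ⟨D', ν, hDD, hν, hmeq⟩ := hm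
      obtain ⟨x₀⟩ := ‹Nonempty X›
      have hS : AEff (Finsupp.single x₀ (s - m)) := fun x => by
        classical
        rw [Finsupp.single_apply]
        split_ifs <;> omega
      have hSd : adeg (Finsupp.single x₀ (s - m)) = s - m := by
        unfold adeg
        exact Finsupp.sum_single_index rfl
      obtain ⟨G, hG, hRG⟩ := hs (posp (D' - ν) + Finsupp.single x₀ (s - m))
        (fun x => add_nonneg (posp_eff _ x) (hS x))
        (by rw [adeg_add', adeg_posp, hSd]; omega)
      apply hν.2
      have h1 := hE2 _ _ _ _ (hequiv.symm hDD) (hequiv.refl (ν - D'))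
      have h2 := hE2 _ _ _ _ hRG (hequiv.refl
        (posp (D' - ν) + Finsupp.single x₀ (s - m) + (ν - D')))
      rw [show D - (posp (D' - ν) + Finsupp.single x₀ (s - m)) +
        (posp (D' - ν) + Finsupp.single x₀ (s - m) + (ν - D')) = D + (ν - D') by abel] at h2
      rw [show D' + (ν - D') = ν by abel] at h1
      refine ⟨_, fun x => ?_, hequiv.trans h1 h2⟩
      have := hG x
      have := hS x
      have := posp_apply (D' - ν) x
      simp only [Finsupp.add_apply, Finsupp.sub_apply] at *
      omega
end
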